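/- arXiv:1706.05516 — 4 statements merged into one kernel-verified Lean document; each statement's English description precedes it below -/
import Mathlib

section
/- S is the direct sum of the two planes P₁ := span_ℝ{X₀, 𝒥₁X₀} and P₂ := span_ℝ{𝒥₂X₀, 𝒥₃X₀}; the canonical pairing vanishes identically on P₁ and on P₂ (both planes are isotropic); and both 𝒥₂ and 𝒥₃ map P₁ onto P₂ and P₂ onto P₁. -/
open Module

/-- The generalized tangent space `W = V ⊕ V*`. -/
abbrev GT (V : Type*) [AddCommGroup V] [Module ℝ V] := V × Module.Dual ℝ V

/-- The canonical symmetric pairing on `W = V ⊕ V*`. -/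
noncomputable def gpair {V : Type*} [AddCommGroup V] [Module ℝ V] (u v : GT V) : ℝ :=
  (1 / 2) * (v.2 u.1 + u.2 v.1)

/-- A generalized almost complex structure on `V`. -/
def IsGacs {V : Type*} [AddCommGroup V] [Module ℝ V] (J : GT V →ₗ[ℝ] GT V) : Prop :=
  (∀ u, J (J u) = -u) ∧ (∀ u v, gpair (J u) v = - gpair u (J v))

/-- A generalized almost Hermitian structure on `V`. -/
structure IsGah {V : Type*} [AddCommGroup V] [Module ℝ V]
    (G : GT V →ₗ[ℝ] GT V →ₗ[ℝ] ℝ) (J Gend : GT V →ₗ[ℝ] GT V) : Prop where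
  gacs : IsGacs J
  symm : ∀ u v, G u v = G v u
  posdef : ∀ u, u ≠ 0 → 0 < G u u
  hermitian : ∀ u v, G (J u) (J v) = G u v
  gend_pair : ∀ u v, G u v = gpair (Gend u) v
  gend_sq : ∀ u, Gend (Gend u) = u

theorem gpair_comm {V : Type*} [AddCommGroup V] [Module ℝ V] (u v : GT V) :
    gpair u v = gpair v u := by
  simp only [gpair]
  ring

theorem gpair_add_left {V : Type*} [AddCommGroup V] [Module ℝ V] (u v w : GT V) :
    gpair (u + v) w = gpair u w + gpair v w := by
  simp only [gpair, Prod.fst_add, Prod.snd_add, map_add, LinearMap.add_apply]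
  ring

theorem gpair_smul_left {V : Type*} [AddCommGroup V] [Module ℝ V] (a : ℝ) (u w : GT V) :
    gpair (a • u) w = a * gpair u w := by
  simp only [gpair, Prod.smul_fst, Prod.smul_snd, map_smul, LinearMap.smul_apply, smul_eq_mul]
  ring

theorem gpair_neg_left {V : Type*} [AddCommGroup V] [Module ℝ V] (u w : GT V) :
    gpair (-u) w = -gpair u w := by
  rw [← neg_one_smul ℝ u, gpair_smul_left, neg_one_mul]

theorem gpair_neg_right {V : Type*} [AddCommGroup V] [Module ℝ V] (u w : GT V) :
    gpair u (-w) = -gpair u w := by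
  rw [gpair_comm, gpair_neg_left, gpair_comm]

/-- The canonical pairing on `V ⊕ V*` is nondegenerate. -/
theorem eq_of_forall_gpair_eq {V : Type*} [AddCommGroup V] [Module ℝ V] {u v : GT V}
    (h : ∀ w, gpair u w = gpair v w) : u = v := by
  refine Prod.ext ?_ (LinearMap.ext fun x => ?_)
  · rw [← sub_eq_zero]
    refine (Module.forall_dual_apply_eq_zero_iff ℝ _).1 fun f => ?_
    have := h (0, f)
    simp only [gpair, map_zero, add_zero] at this
    rw [map_sub]
    linarith
  · have := h (x, 0)
    simp only [gpair, LinearMap.zero_apply, zero_add] at this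
    linarith

/-- The canonical pairing vanishes on the span of two isotropic, mutually orthogonal vectors. -/
theorem gpair_eq_zero_of_mem_span_pair {V : Type*} [AddCommGroup V] [Module ℝ V] {a b : GT V}
    (haa : gpair a a = 0) (hab : gpair a b = 0) (hbb : gpair b b = 0)
    {u v : GT V} (hu : u ∈ Submodule.span ℝ {a, b}) (hv : v ∈ Submodule.span ℝ {a, b}) :
    gpair u v = 0 := by
  obtain ⟨p, q, rfl⟩ := Submodule.mem_span_pair.1 hu
  obtain ⟨r, s, rfl⟩ := Submodule.mem_span_pair.1 hv
  have hba : gpair b a = 0 := by rw [gpair_comm, hab]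
  have key : ∀ c, gpair a c = 0 → gpair b c = 0 → gpair (p • a + q • b) c = 0 := by
    intro c ha hb
    rw [gpair_add_left, gpair_smul_left, gpair_smul_left, ha, hb]
    ring
  rw [gpair_comm, gpair_add_left, gpair_smul_left, gpair_smul_left, gpair_comm a,
    gpair_comm b, key a haa hba, key b hab hbb]
  ring

theorem IsGacs.gpair_map_map {V : Type*} [AddCommGroup V] [Module ℝ V]
    {J : GT V →ₗ[ℝ] GT V} (h : IsGacs J) (u v : GT V) : gpair (J u) (J v) = gpair u v := by
  rw [h.2, h.1, gpair_neg_right, neg_neg]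

theorem IsGacs.gpair_self_map {V : Type*} [AddCommGroup V] [Module ℝ V]
    {J : GT V →ₗ[ℝ] GT V} (h : IsGacs J) (u : GT V) : gpair u (J u) = 0 := by
  have := h.2 u u
  rw [gpair_comm] at this
  linarith

theorem IsGah.gend_comm {V : Type*} [AddCommGroup V] [Module ℝ V]
    {G : GT V →ₗ[ℝ] GT V →ₗ[ℝ] ℝ} {J Gend : GT V →ₗ[ℝ] GT V} (h : IsGah G J Gend) (u : GT V) :
    J (Gend u) = Gend (J u) := by
  refine eq_of_forall_gpair_eq fun w => ?_
  rw [h.gacs.2, ← h.gend_pair, ← h.gend_pair, ← h.hermitian (J u) w, h.gacs.1, map_neg,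
    LinearMap.neg_apply]

theorem IsGah.gpair_gend_gend {V : Type*} [AddCommGroup V] [Module ℝ V]
    {G : GT V →ₗ[ℝ] GT V →ₗ[ℝ] ℝ} {J Gend : GT V →ₗ[ℝ] GT V} (h : IsGah G J Gend)
    (u v : GT V) : gpair (Gend u) (Gend v) = gpair u v := by
  rw [← h.gend_pair, h.symm, h.gend_pair, h.gend_sq, gpair_comm]

/-- An isotropic subspace meets its image under the metric involution trivially. -/
theorem IsGah.inf_map_gend_eq_bot {V : Type*} [AddCommGroup V] [Module ℝ V]
    {G : GT V →ₗ[ℝ] GT V →ₗ[ℝ] ℝ} {J Gend : GT V →ₗ[ℝ] GT V} (h : IsGah G J Gend)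
    {P : Submodule ℝ (GT V)} (hP : ∀ u ∈ P, ∀ v ∈ P, gpair u v = 0) :
    P ⊓ P.map Gend = ⊥ := by
  refine (Submodule.eq_bot_iff _).2 ?_
  rintro _ ⟨hu, w, hw, rfl⟩
  by_contra hne
  have hpos := h.posdef _ hne
  rw [h.gend_pair, h.gend_sq, hP _ hw _ hu] at hpos
  exact lt_irrefl _ hpos

theorem span_pair_neg_left {M : Type*} [AddCommGroup M] [Module ℝ M] (a b : M) :
    Submodule.span ℝ {-a, b} = Submodule.span ℝ {a, b} := by
  rw [Submodule.span_insert, Submodule.span_insert a, ← Set.neg_singleton, Submodule.span_neg]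

theorem span_pair_neg_right {M : Type*} [AddCommGroup M] [Module ℝ M] (a b : M) :
    Submodule.span ℝ {a, -b} = Submodule.span ℝ {a, b} := by
  rw [Set.pair_comm, span_pair_neg_left, Set.pair_comm]


/-- with `e = X₀ + 0 ∈ W`, `S = span{e, 𝒥₁e, 𝒥₂e, 𝒥₃e}`,
`P₁ = span{e, 𝒥₁e}` and `P₂ = span{𝒥₂e, 𝒥₃e}`: `S` is the direct sum of `P₁` and
`P₂`; the canonical pairing vanishes identically on `P₁` and on `P₂`; and both `𝒥₂`
and `𝒥₃` map `P₁` onto `P₂` and `P₂` onto `P₁`. -/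
theorem statement6 {V : Type*} [AddCommGroup V] [Module ℝ V] [FiniteDimensional ℝ V]
    (G : GT V →ₗ[ℝ] GT V →ₗ[ℝ] ℝ) (J Gend : GT V →ₗ[ℝ] GT V)
    (hGah : IsGah G J Gend) (X₀ : V) (hX₀ : X₀ ≠ 0) :
    letI e : GT V := (X₀, 0)
    letI J₂ : GT V →ₗ[ℝ] GT V := Gend ∘ₗ J
    letI J₃ : GT V →ₗ[ℝ] GT V := J ∘ₗ Gend ∘ₗ J
    letI S : Submodule ℝ (GT V) := Submodule.span ℝ {e, J e, J₂ e, J₃ e}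
    letI P₁ : Submodule ℝ (GT V) := Submodule.span ℝ {e, J e}
    letI P₂ : Submodule ℝ (GT V) := Submodule.span ℝ {J₂ e, J₃ e}
    (S = P₁ ⊔ P₂ ∧ P₁ ⊓ P₂ = ⊥) ∧
    (∀ u ∈ P₁, ∀ v ∈ P₁, gpair u v = 0) ∧
    (∀ u ∈ P₂, ∀ v ∈ P₂, gpair u v = 0) ∧
    (P₁.map J₂ = P₂ ∧ P₂.map J₂ = P₁ ∧ P₁.map J₃ = P₂ ∧ P₂.map J₃ = P₁) := by
  have hJ := hGah.gacs
  have hcomm := hGah.gend_comm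
  have hJ₃ : J ∘ₗ Gend ∘ₗ J = -Gend := LinearMap.ext fun u => by
    rw [LinearMap.comp_apply, LinearMap.comp_apply, hcomm, hJ.1, map_neg, LinearMap.neg_apply]
  have hee : gpair ((X₀, 0) : GT V) (X₀, 0) = 0 := by simp [gpair]
  generalize ((X₀, 0) : GT V) = e at hee ⊢
  have hP₁ : ∀ u ∈ Submodule.span ℝ {e, J e}, ∀ v ∈ Submodule.span ℝ {e, J e}, gpair u v = 0 :=
    fun u hu v hv => gpair_eq_zero_of_mem_span_pair hee (hJ.gpair_self_map e)
      ((hJ.gpair_map_map e e).trans hee) hu hv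
  have hP₂ : Submodule.span ℝ {(Gend ∘ₗ J) e, (J ∘ₗ Gend ∘ₗ J) e} =
      (Submodule.span ℝ {e, J e}).map Gend := by
    simp only [Submodule.map_span, Set.image_pair, hJ₃, LinearMap.comp_apply,
      LinearMap.neg_apply, span_pair_neg_right]
    rw [Set.pair_comm]
  refine ⟨⟨?_, ?_⟩, hP₁, ?_, ?_, ?_, ?_, ?_⟩
  · rw [← Submodule.span_union, Set.insert_union, Set.singleton_union]
  · rw [hP₂]
    exact hGah.inf_map_gend_eq_bot hP₁
  · rw [hP₂]
    rintro _ ⟨u, hu, rfl⟩ _ ⟨v, hv, rfl⟩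
    rw [hGah.gpair_gend_gend]
    exact hP₁ u hu v hv
  · simp only [hJ₃, Submodule.map_span, Set.image_pair, LinearMap.comp_apply,
      LinearMap.neg_apply, hJ.1, map_neg]
  · simp only [hJ₃, Submodule.map_span, Set.image_pair, LinearMap.comp_apply,
      LinearMap.neg_apply, hJ.1, map_neg, hcomm, hGah.gend_sq, span_pair_neg_left,
      span_pair_neg_right]
  · simp only [hJ₃, Submodule.map_span, Set.image_pair, LinearMap.comp_apply,
      LinearMap.neg_apply, span_pair_neg_left, span_pair_neg_right]
    rw [Set.pair_comm]
  · simp only [hJ₃, Submodule.map_span, Set.image_pair, LinearMap.comp_apply,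
      LinearMap.neg_apply, map_neg, neg_neg, hGah.gend_sq, span_pair_neg_left]
    rw [Set.pair_comm]
end

section
/- The restriction of the canonical pairing to S is nondegenerate, and the orthogonal complement of S in W with respect to G coincides with the orthogonal complement of S with respect to the canonical pairing. -/
open Module

namespace IsGah

variable {V : Type*} [AddCommGroup V] [Module ℝ V]
  {G : GT V →ₗ[ℝ] GT V →ₗ[ℝ] ℝ} {J Gend : GT V →ₗ[ℝ] GT V}

theorem eq_zero_of_self_eq_zero (h : IsGah G J Gend) {u : GT V} (hu : G u u = 0) : u = 0 := by
  by_contra hne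
  exact (h.posdef u hne).ne' hu

theorem apply_gend_left (h : IsGah G J Gend) (u v : GT V) : G (Gend u) v = gpair u v := by
  rw [h.gend_pair, h.gend_sq]

theorem apply_gend_right (h : IsGah G J Gend) (u v : GT V) : G u (Gend v) = gpair u v := by
  rw [h.symm, h.apply_gend_left, gpair_comm]

theorem gend_J_gend_J (h : IsGah G J Gend) (u : GT V) : Gend (J (Gend (J u))) = -u := by
  have key (v : GT V) : G (Gend (J (Gend (J u))) + u) v = 0 := by
    rw [map_add, LinearMap.add_apply, h.apply_gend_left, h.gacs.2, ← h.gend_pair, h.hermitian]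
    ring
  exact eq_neg_of_add_eq_zero_left (h.eq_zero_of_self_eq_zero (key _))

theorem gend_mem_span (h : IsGah G J Gend) (e : GT V) {s : GT V}
    (hs : s ∈ Submodule.span ℝ {e, J e, Gend (J e), J (Gend (J e))}) :
    Gend s ∈ Submodule.span ℝ {e, J e, Gend (J e), J (Gend (J e))} := by
  set S := Submodule.span ℝ {e, J e, Gend (J e), J (Gend (J e))} with hS
  have he : e ∈ S := Submodule.subset_span (by simp)
  have hJ : J e ∈ S := Submodule.subset_span (by simp)
  have hGJ : Gend (J e) ∈ S := Submodule.subset_span (by simp)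
  have hJGJ : J (Gend (J e)) ∈ S := Submodule.subset_span (by simp)
  suffices S ≤ S.comap Gend from this hs
  conv_lhs => rw [hS]
  rw [Submodule.span_le]
  rintro x (rfl | rfl | rfl | rfl)
  · have hx : Gend x = -J (Gend (J x)) := by
      rw [← h.gend_sq (J (Gend (J x))), h.gend_J_gend_J, map_neg, neg_neg]
    simpa [hx] using hJGJ
  · exact hGJ
  · simpa [h.gend_sq] using hJ
  · simpa [h.gend_J_gend_J] using he

end IsGah

/-- the restriction of the canonical pairing to
`S = span{X₀, 𝒥₁X₀, 𝒥₂X₀, 𝒥₃X₀}` is nondegenerate, and the orthogonal complement of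
`S` in `W` with respect to `G` coincides with the orthogonal complement of `S` with
respect to the canonical pairing. -/
theorem statement7 {V : Type*} [AddCommGroup V] [Module ℝ V] [FiniteDimensional ℝ V]
    (G : GT V →ₗ[ℝ] GT V →ₗ[ℝ] ℝ) (J Gend : GT V →ₗ[ℝ] GT V)
    (hGah : IsGah G J Gend) (X₀ : V) (hX₀ : X₀ ≠ 0) :
    letI e : GT V := (X₀, 0)
    letI J₂ : GT V →ₗ[ℝ] GT V := Gend ∘ₗ J
    letI J₃ : GT V →ₗ[ℝ] GT V := J ∘ₗ Gend ∘ₗ J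
    letI S : Submodule ℝ (GT V) := Submodule.span ℝ {e, J e, J₂ e, J₃ e}
    (∀ u ∈ S, (∀ v ∈ S, gpair u v = 0) → u = 0) ∧
    {w : GT V | ∀ s ∈ S, G w s = 0} = {w : GT V | ∀ s ∈ S, gpair w s = 0} := by
  set S : Submodule ℝ (GT V) :=
    Submodule.span ℝ {(X₀, 0), J (X₀, 0), (Gend ∘ₗ J) (X₀, 0), (J ∘ₗ Gend ∘ₗ J) (X₀, 0)}
  have hS {s : GT V} (hs : s ∈ S) : Gend s ∈ S := hGah.gend_mem_span (X₀, 0) hs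
  refine ⟨fun u hu h => hGah.eq_zero_of_self_eq_zero ?_, Set.ext fun w => ⟨fun h s hs => ?_,
    fun h s hs => ?_⟩⟩
  · rw [hGah.gend_pair, gpair_comm]
    exact h _ (hS hu)
  · rw [← hGah.apply_gend_right]
    exact h _ (hS hs)
  · rw [← hGah.gend_sq s, hGah.apply_gend_right]
    exact h _ (hS hs)
end

section
/- Let g be an inner product on V, J a complex structure on V (J² = −Id) with g(JX, JY) = g(X, Y), and consider the induced generalized almost Hermitian structure on V given by 𝒥(X+ξ) := JX − ξ∘J and G(X+ξ, Y+η) := (1/2)(g(X, Y) + g⁻¹(ξ, η)), where g⁻¹ is the inner product induced by g on V*. Fix a nonzero X₀ ∈ V and a nonzero real f, and let (G', 𝒥) be the elementary deformation of (G, 𝒥) by X₀ and f. Then (G', 𝒥) is the generalized almost Hermitian structure induced in the same way by the pair (g', J), where g' is the inner product on V for which span{X₀, JX₀} and its g-orthogonal complement are g'-orthogonal, g' = (1/f²)·g on span{X₀, JX₀} and g' = g on the g-orthogonal complement of span{X₀, JX₀}. -/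
open Module

/-- The generalized almost complex structure `𝒥(X+ξ) = JX − ξ∘J` induced by an almost
complex structure `J` on `V`. -/
def Jcplx {V : Type*} [AddCommGroup V] [Module ℝ V] (J : V →ₗ[ℝ] V) :
    GT V →ₗ[ℝ] GT V :=
  LinearMap.prodMap J (-J.dualMap)

/-- The generalized metric `G(X+ξ, Y+η) = (1/2)(g(X,Y) + g⁻¹(ξ,η))` on `W = V ⊕ V*`
induced by a metric `g` on `V`, given with its musical isomorphism `gflat : V ≃ V*`. -/
noncomputable def inducedG {V : Type*} [AddCommGroup V] [Module ℝ V]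
    (g : V →ₗ[ℝ] V →ₗ[ℝ] ℝ) (gflat : V ≃ₗ[ℝ] Module.Dual ℝ V) :
    GT V →ₗ[ℝ] GT V →ₗ[ℝ] ℝ :=
  (1 / 2 : ℝ) •
    (g.compl₁₂ (LinearMap.fst ℝ V (Module.Dual ℝ V)) (LinearMap.fst ℝ V (Module.Dual ℝ V)) +
      (LinearMap.id : Module.Dual ℝ V →ₗ[ℝ] Module.Dual ℝ V).compl₁₂
        (LinearMap.snd ℝ V (Module.Dual ℝ V))
        (gflat.symm.toLinearMap ∘ₗ LinearMap.snd ℝ V (Module.Dual ℝ V)))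

/-- The endomorphism `G^end(X+ξ) = g⁻¹ξ + g(X)` of the induced generalized metric. -/
noncomputable def inducedGend {V : Type*} [AddCommGroup V] [Module ℝ V]
    (gflat : V ≃ₗ[ℝ] Module.Dual ℝ V) : GT V →ₗ[ℝ] GT V :=
  LinearMap.prod (gflat.symm.toLinearMap ∘ₗ LinearMap.snd ℝ V (Module.Dual ℝ V))
    (gflat.toLinearMap ∘ₗ LinearMap.fst ℝ V (Module.Dual ℝ V))

/-- Every vector splits along `span {A, B}` and its orthogonal complement when `A`, `B` are
orthogonal with `g A A` and `g B B` nonzero. -/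
lemma exists_add_orthogonal_span_pair {V : Type*} [AddCommGroup V] [Module ℝ V]
    (g : V →ₗ[ℝ] V →ₗ[ℝ] ℝ) (gsymm : ∀ X Y : V, g X Y = g Y X) {A B : V}
    (hA : g A A ≠ 0) (hB : g B B ≠ 0) (hAB : g A B = 0) (X : V) :
    ∃ P ∈ Submodule.span ℝ {A, B}, ∃ Q : V,
      (∀ Z ∈ Submodule.span ℝ {A, B}, g Q Z = 0) ∧ X = P + Q := by
  have hBA : g B A = 0 := gsymm B A ▸ hAB
  refine ⟨(g X A / g A A) • A + (g X B / g B B) • B,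
    Submodule.mem_span_pair.2 ⟨_, _, rfl⟩,
    X - ((g X A / g A A) • A + (g X B / g B B) • B), fun Z hZ => ?_, by abel⟩
  obtain ⟨a, b, rfl⟩ := Submodule.mem_span_pair.1 hZ
  simp only [map_add, map_sub, map_smul, LinearMap.sub_apply, LinearMap.add_apply,
    LinearMap.smul_apply, smul_eq_mul, hAB, hBA]
  field_simp
  ring

/-- the elementary deformation (by a nonzero `X₀ ∈ V` and a nonzero real
`f`) of the generalized almost Hermitian structure induced by a Hermitian structure
`(g, J)` on `V` is the generalized almost Hermitian structure induced by `(g', J)`,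
where `g'` is the metric equal to `(1/f²)g` on `span{X₀, JX₀}`, equal to `g` on the
`g`-orthogonal complement of `span{X₀, JX₀}`, and making these two subspaces
`g'`-orthogonal. -/
theorem statement12 {V : Type*} [AddCommGroup V] [Module ℝ V] [FiniteDimensional ℝ V]
    (g : V →ₗ[ℝ] V →ₗ[ℝ] ℝ) (gsymm : ∀ X Y : V, g X Y = g Y X)
    (gpos : ∀ X : V, X ≠ 0 → 0 < g X X)
    (J : V →ₗ[ℝ] V) (hJsq : ∀ X : V, J (J X) = -X)
    (hJg : ∀ X Y : V, g (J X) (J Y) = g X Y)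
    (gflat : V ≃ₗ[ℝ] Module.Dual ℝ V) (hgflat : ∀ X Y : V, gflat X Y = g X Y)
    (X₀ : V) (hX₀ : X₀ ≠ 0) (f : ℝ) (hf : f ≠ 0)
    -- the elementary deformation automorphism τ
    (τ : GT V ≃ₗ[ℝ] GT V)
    (hτperp : ∀ w : GT V,
      (∀ s ∈ Submodule.span ℝ {((X₀, 0) : GT V), Jcplx J (X₀, 0),
          (inducedGend gflat ∘ₗ Jcplx J) (X₀, 0),
          (Jcplx J ∘ₗ inducedGend gflat ∘ₗ Jcplx J) (X₀, 0)}, gpair w s = 0) → τ w = w)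
    (hτ0 : τ ((X₀, 0) : GT V) = f • ((X₀, 0) : GT V))
    (hτ1 : τ (Jcplx J (X₀, 0)) = f • Jcplx J (X₀, 0))
    (hτ2 : τ ((inducedGend gflat ∘ₗ Jcplx J) (X₀, 0)) =
      f⁻¹ • (inducedGend gflat ∘ₗ Jcplx J) (X₀, 0))
    (hτ3 : τ ((Jcplx J ∘ₗ inducedGend gflat ∘ₗ Jcplx J) (X₀, 0)) =
      f⁻¹ • (Jcplx J ∘ₗ inducedGend gflat ∘ₗ Jcplx J) (X₀, 0))
    -- the deformed metric g' on V
    (g' : V →ₗ[ℝ] V →ₗ[ℝ] ℝ)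
    (hg'span : ∀ X ∈ Submodule.span ℝ {X₀, J X₀}, ∀ Y ∈ Submodule.span ℝ {X₀, J X₀},
      g' X Y = (f ^ 2)⁻¹ * g X Y)
    (hg'perp : ∀ X Y : V, (∀ Z ∈ Submodule.span ℝ {X₀, J X₀}, g X Z = 0) →
      (∀ Z ∈ Submodule.span ℝ {X₀, J X₀}, g Y Z = 0) → g' X Y = g X Y)
    (hg'orth : ∀ X ∈ Submodule.span ℝ {X₀, J X₀}, ∀ Y : V,
      (∀ Z ∈ Submodule.span ℝ {X₀, J X₀}, g Y Z = 0) → g' X Y = 0 ∧ g' Y X = 0)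
    (g'flat : V ≃ₗ[ℝ] Module.Dual ℝ V) (hg'flat : ∀ X Y : V, g'flat X Y = g' X Y) :
    ∀ u v : GT V, inducedG g gflat (τ.symm u) (τ.symm v) = inducedG g' g'flat u v := by
  have hJskew : ∀ X Y : V, g (J X) Y = -g X (J Y) := fun X Y => by
    rw [← hJg X (J Y), hJsq, map_neg, neg_neg]
  have hJX₀ : J X₀ ≠ 0 := fun h => hX₀ <| by
    have := hJsq X₀
    rw [h, map_zero] at this
    exact neg_eq_zero.1 this.symm
  have hX₀J : g X₀ (J X₀) = 0 := by
    have := hJskew X₀ X₀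
    rw [gsymm (J X₀) X₀] at this
    linarith
  have split := exists_add_orthogonal_span_pair g gsymm (gpos _ hX₀).ne' (gpos _ hJX₀).ne' hX₀J
  have e1 : Jcplx J (X₀, 0) = ((J X₀, 0) : GT V) := by simp [Jcplx]
  have e2 : (inducedGend gflat ∘ₗ Jcplx J) (X₀, 0) = ((0, gflat (J X₀)) : GT V) := by
    simp [e1, inducedGend]
  have e3 : (Jcplx J ∘ₗ inducedGend gflat ∘ₗ Jcplx J) (X₀, 0) =
      ((0, -gflat X₀) : GT V) := by
    rw [LinearMap.comp_apply, e2]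
    refine Prod.ext (by simp [Jcplx]) (LinearMap.ext fun Y => ?_)
    simp [Jcplx, hgflat, hJg]
  simp only [e1, e2, e3] at hτperp hτ1 hτ2 hτ3
  have τvec : ∀ P ∈ Submodule.span ℝ {X₀, J X₀}, τ (P, 0) = (f • P, 0) := fun P hP => by
    obtain ⟨a, b, rfl⟩ := Submodule.mem_span_pair.1 hP
    have : ((a • X₀ + b • J X₀, 0) : GT V) = a • (X₀, 0) + b • (J X₀, 0) := by simp
    rw [this, map_add, map_smul, map_smul, hτ0, hτ1]
    simp [smul_comm f]
  have τcovec : ∀ P ∈ Submodule.span ℝ {X₀, J X₀},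
      τ (0, gflat P) = (0, gflat (f⁻¹ • P)) := fun P hP => by
    obtain ⟨a, b, rfl⟩ := Submodule.mem_span_pair.1 hP
    have : ((0, gflat (a • X₀ + b • J X₀)) : GT V) =
        (-a) • (0, -gflat X₀) + b • (0, gflat (J X₀)) := by simp
    rw [this, map_add, map_smul, map_smul, hτ2, hτ3]
    simp [smul_comm f⁻¹]
  have τperp : ∀ Q S : V, (∀ Z ∈ Submodule.span ℝ {X₀, J X₀}, g Q Z = 0) →
      (∀ Z ∈ Submodule.span ℝ {X₀, J X₀}, g S Z = 0) →
      τ (Q, gflat S) = (Q, gflat S) := fun Q S hQ hS => by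
    have m0 : X₀ ∈ Submodule.span ℝ {X₀, J X₀} := Submodule.subset_span (by simp)
    have m1 : J X₀ ∈ Submodule.span ℝ {X₀, J X₀} := Submodule.subset_span (by simp)
    refine hτperp _ fun s hs => ?_
    induction hs using Submodule.span_induction with
    | mem s hs =>
      rcases hs with rfl | rfl | rfl | rfl <;>
        simp [gpair, hgflat, hS _ m0, hS _ m1, gsymm _ Q, hQ _ m0, hQ _ m1]
    | zero => simp [gpair]
    | add s t _ _ h h' =>
      simp only [gpair, Prod.fst_add, Prod.snd_add, map_add, LinearMap.add_apply] at h h' ⊢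
      linarith
    | smul c s _ h =>
      simp only [gpair, Prod.smul_fst, Prod.smul_snd, map_smul, LinearMap.smul_apply,
        smul_eq_mul] at h ⊢
      linear_combination c * h
  have τsplit : ∀ P ∈ Submodule.span ℝ {X₀, J X₀}, ∀ R ∈ Submodule.span ℝ {X₀, J X₀},
      ∀ Q S : V, (∀ Z ∈ Submodule.span ℝ {X₀, J X₀}, g Q Z = 0) →
      (∀ Z ∈ Submodule.span ℝ {X₀, J X₀}, g S Z = 0) →
      τ (P + Q, gflat (R + S)) = (f • P + Q, gflat (f⁻¹ • R + S)) :=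
    fun P hP R hR Q S hQ hS => by
      have : ((P + Q, gflat (R + S)) : GT V) = (P, 0) + (0, gflat R) + (Q, gflat S) := by simp
      rw [this, map_add, map_add, τvec P hP, τcovec R hR, τperp Q S hQ hS]
      simp
  have g'split : ∀ P ∈ Submodule.span ℝ {X₀, J X₀}, ∀ Q : V,
      (∀ Z ∈ Submodule.span ℝ {X₀, J X₀}, g Q Z = 0) →
      ∀ Y : V, g' (f • P + Q) Y = g (f⁻¹ • P + Q) Y := fun P hP Q hQ Y => by
    obtain ⟨P', hP', Q', hQ', rfl⟩ := split Y
    have h0 : g P Q' = 0 := by rw [gsymm, hQ' P hP]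
    simp only [map_add, map_smul, LinearMap.add_apply, LinearMap.smul_apply, smul_eq_mul,
      hg'span P hP P' hP', (hg'orth P hP Q' hQ').1, (hg'orth P' hP' Q hQ).2,
      hg'perp Q Q' hQ hQ', h0, hQ P' hP']
    field_simp
    ring
  have flat_split : ∀ R ∈ Submodule.span ℝ {X₀, J X₀}, ∀ S : V,
      (∀ Z ∈ Submodule.span ℝ {X₀, J X₀}, g S Z = 0) →
      g'flat.symm (gflat (f⁻¹ • R + S)) = f • R + S := fun R hR S hS => by
    rw [LinearEquiv.symm_apply_eq]
    ext Y
    rw [hg'flat, hgflat, g'split R hR S hS]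
  intro u v
  obtain ⟨⟨X, ξ⟩, rfl⟩ := τ.surjective u
  obtain ⟨⟨Y, η⟩, rfl⟩ := τ.surjective v
  obtain ⟨A, rfl⟩ := gflat.surjective ξ
  obtain ⟨B, rfl⟩ := gflat.surjective η
  obtain ⟨P₁, hP₁, Q₁, hQ₁, rfl⟩ := split X
  obtain ⟨P₂, hP₂, Q₂, hQ₂, rfl⟩ := split Y
  obtain ⟨R₁, hR₁, S₁, hS₁, rfl⟩ := split A
  obtain ⟨R₂, hR₂, S₂, hS₂, rfl⟩ := split B
  rw [τ.symm_apply_apply, τ.symm_apply_apply, τsplit P₁ hP₁ R₁ hR₁ Q₁ S₁ hQ₁ hS₁,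
    τsplit P₂ hP₂ R₂ hR₂ Q₂ S₂ hQ₂ hS₂]
  simp only [inducedG, LinearMap.smul_apply, LinearMap.add_apply, LinearMap.compl₁₂_apply,
    LinearMap.fst_apply, LinearMap.snd_apply, LinearMap.comp_apply, LinearEquiv.coe_coe,
    LinearMap.id_apply, LinearEquiv.symm_apply_apply, flat_split R₂ hR₂ S₂ hS₂, hgflat,
    g'split P₁ hP₁ Q₁ hQ₁]
  have hPQ : g P₁ Q₂ = 0 := by rw [gsymm, hQ₂ P₁ hP₁]
  have hRS : g R₁ S₂ = 0 := by rw [gsymm, hS₂ R₁ hR₁]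
  simp only [map_add, map_smul, LinearMap.add_apply, LinearMap.smul_apply, smul_eq_mul,
    hPQ, hRS, hQ₁ P₂ hP₂, hS₁ R₂ hR₂]
  field_simp
  ring
end

section
/- Let Ψ be a real 2×2 matrix whose symmetric part Ψ^s := (1/2)(Ψ + Ψᵀ) is positive definite, and let C₁₂ denote the (1,2) entry of its antisymmetric part Ψ^a := (1/2)(Ψ − Ψᵀ). Then det Ψ = det Ψ^s + C₁₂², so det Ψ − C₁₂² > 0 and Ψ, Ψ^s, (Ψ⁻¹)^s are invertible, and the first row of the matrix (Ψ⁻¹)^a · [(Ψ⁻¹)^s]⁻¹ equals −C₁₂/(det Ψ − C₁₂²) · ((Ψ^s)₁₂, Ψ₂₂); in particular this first row is zero if and only if C₁₂ = 0. -/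
open Matrix

/-- The symmetric part of a square matrix. -/
noncomputable def symPart (Ψ : Matrix (Fin 2) (Fin 2) ℝ) : Matrix (Fin 2) (Fin 2) ℝ :=
  (1 / 2 : ℝ) • (Ψ + Ψᵀ)

/-- The antisymmetric part of a square matrix. -/
noncomputable def asymPart (Ψ : Matrix (Fin 2) (Fin 2) ℝ) : Matrix (Fin 2) (Fin 2) ℝ :=
  (1 / 2 : ℝ) • (Ψ - Ψᵀ)

theorem det_eq_det_symPart_add_sq (Ψ : Matrix (Fin 2) (Fin 2) ℝ) :
    Ψ.det = (symPart Ψ).det + asymPart Ψ 0 1 ^ 2 := by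
  simp [det_fin_two, symPart, asymPart]
  ring

theorem symPart_inv (Ψ : Matrix (Fin 2) (Fin 2) ℝ) :
    symPart Ψ⁻¹ = Ψ.det⁻¹ • (symPart Ψ).adjugate := by
  ext i j
  fin_cases i <;> fin_cases j <;>
    simp [symPart, inv_def, adjugate_fin_two] <;> ring

theorem asymPart_inv (Ψ : Matrix (Fin 2) (Fin 2) ℝ) :
    asymPart Ψ⁻¹ = -(Ψ.det⁻¹ • asymPart Ψ) := by
  ext i j
  fin_cases i <;> fin_cases j <;>
    simp [asymPart, inv_def, adjugate_fin_two] <;> ring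

theorem inv_symPart_inv {Ψ : Matrix (Fin 2) (Fin 2) ℝ} (hΨ : Ψ.det ≠ 0)
    (hS : (symPart Ψ).det ≠ 0) :
    (symPart Ψ⁻¹)⁻¹ = (Ψ.det / (symPart Ψ).det) • symPart Ψ := by
  apply inv_eq_right_inv
  rw [symPart_inv, smul_mul_smul_comm, adjugate_mul, smul_smul]
  field_simp
  simp

theorem asymPart_inv_mul_inv_symPart_inv {Ψ : Matrix (Fin 2) (Fin 2) ℝ} (hΨ : Ψ.det ≠ 0)
    (hS : (symPart Ψ).det ≠ 0) :
    asymPart Ψ⁻¹ * (symPart Ψ⁻¹)⁻¹ = -((symPart Ψ).det⁻¹ • (asymPart Ψ * symPart Ψ)) := by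
  rw [inv_symPart_inv hΨ hS, asymPart_inv, neg_mul, smul_mul_smul_comm]
  congr 2
  field_simp

/-- for a real 2×2 matrix `Ψ` with positive-definite symmetric part `Ψˢ`
and `C₁₂` the `(1,2)` entry of its antisymmetric part: `det Ψ = det Ψˢ + C₁₂²`, so
`det Ψ − C₁₂² > 0` and `Ψ, Ψˢ, (Ψ⁻¹)ˢ` are invertible, and the first row of
`(Ψ⁻¹)ᵃ · [(Ψ⁻¹)ˢ]⁻¹` equals `−C₁₂/(det Ψ − C₁₂²) · ((Ψˢ)₁₂, Ψ₂₂)`; in particular this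
first row is zero iff `C₁₂ = 0`. -/
theorem statement18 (Ψ : Matrix (Fin 2) (Fin 2) ℝ) (hpos : (symPart Ψ).PosDef) :
    letI C₁₂ : ℝ := asymPart Ψ 0 1
    letI M : Matrix (Fin 2) (Fin 2) ℝ := asymPart Ψ⁻¹ * (symPart Ψ⁻¹)⁻¹
    Ψ.det = (symPart Ψ).det + C₁₂ ^ 2 ∧
    0 < Ψ.det - C₁₂ ^ 2 ∧
    (IsUnit Ψ ∧ IsUnit (symPart Ψ) ∧ IsUnit (symPart Ψ⁻¹)) ∧
    (M 0 0 = -C₁₂ / (Ψ.det - C₁₂ ^ 2) * symPart Ψ 0 1 ∧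
      M 0 1 = -C₁₂ / (Ψ.det - C₁₂ ^ 2) * Ψ 1 1) ∧
    ((M 0 0 = 0 ∧ M 0 1 = 0) ↔ C₁₂ = 0) := by
  have hdet := det_eq_det_symPart_add_sq Ψ
  have hS : 0 < (symPart Ψ).det := hpos.det_pos
  have hΨ : 0 < Ψ.det := by rw [hdet]; positivity
  have hsub : Ψ.det - asymPart Ψ 0 1 ^ 2 = (symPart Ψ).det := by rw [hdet]; ring
  have hdiag (A : Matrix (Fin 2) (Fin 2) ℝ) : asymPart A 0 0 = 0 := by simp [asymPart]
  have h11 : symPart Ψ 1 1 = Ψ 1 1 := by simp [symPart]; ring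
  have hpos11 : 0 < Ψ 1 1 := h11 ▸ hpos.diag_pos
  have hsymm : symPart Ψ 1 0 = symPart Ψ 0 1 := by simp [symPart, add_comm]
  have hM := asymPart_inv_mul_inv_symPart_inv hΨ.ne' hS.ne'
  have hM0 : (asymPart Ψ⁻¹ * (symPart Ψ⁻¹)⁻¹) 0 0 =
      -asymPart Ψ 0 1 / (symPart Ψ).det * symPart Ψ 0 1 := by
    rw [hM]
    simp only [Matrix.neg_apply, Matrix.smul_apply, Matrix.mul_apply,
      Fin.sum_univ_two, hdiag, hsymm, smul_eq_mul]
    ring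
  have hM1 : (asymPart Ψ⁻¹ * (symPart Ψ⁻¹)⁻¹) 0 1 =
      -asymPart Ψ 0 1 / (symPart Ψ).det * Ψ 1 1 := by
    rw [hM]
    simp only [Matrix.neg_apply, Matrix.smul_apply, Matrix.mul_apply,
      Fin.sum_univ_two, hdiag, h11, smul_eq_mul]
    ring
  have hunit : IsUnit (symPart Ψ⁻¹) := by
    rw [isUnit_iff_isUnit_det, isUnit_iff_ne_zero, symPart_inv, det_smul, det_adjugate]
    simp [hΨ.ne', hS.ne']
  refine ⟨hdet, hsub ▸ hS, ⟨?_, hpos.isUnit, hunit⟩, ?_, ?_⟩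
  · exact (isUnit_iff_isUnit_det _).2 hΨ.ne'.isUnit
  · rw [hsub]
    exact ⟨hM0, hM1⟩
  · rw [hM0, hM1]
    constructor
    · rintro ⟨-, h⟩
      simpa [hS.ne', hpos11.ne'] using h
    · intro h
      simp [h]
end
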